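/- Assume hypotheses (A1), (A2) and (A3), and let ρ be the unique positive zero of F̄(r) = ∫_{−1}^{1} √(1 − s²) f(r s) ds. Then there exists x₀ > max{ρ, −x₁, x₂} such that for every λ > 0 every nonconstant periodic solution t ↦ (x(t), y(t)) of (S1) satisfies −x₀ < x(t) < x₀ for all t. Moreover, for every λ > 0, every nonconstant periodic solution of (S1) intersects one of the lines x = x_M or x = x_m, i.e., there exists t with x(t) = x_M or x(t) = x_m. -/

import Mathlib

/-- A nonconstant periodic solution of the Liénard system
`x' = y, y' = -x - λ f(x) y`. -/
def IsPeriodicSol (f : ℝ → ℝ) (lam : ℝ) (x y : ℝ → ℝ) : Prop :=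
  (∃ T : ℝ, 0 < T ∧ ∀ t, x (t + T) = x t ∧ y (t + T) = y t) ∧
  (∀ t, HasDerivAt x (y t) t) ∧
  (∀ t, HasDerivAt y (-(x t) - lam * f (x t) * y t) t) ∧
  (∃ t₁ t₂, (x t₁, y t₁) ≠ (x t₂, y t₂))

open Set Filter Topology

/-- The square of the positive part is continuously differentiable. -/
lemma hasDerivAt_max_zero_sq (r : ℝ) :
    HasDerivAt (fun r : ℝ => (max r 0) ^ 2) (2 * max r 0) r := by
  rcases lt_trichotomy r 0 with h | rfl | h
  · rw [max_eq_right h.le, mul_zero]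
    refine (hasDerivAt_const r (0 : ℝ)).congr_of_eventuallyEq ?_
    filter_upwards [Iio_mem_nhds h] with s hs
    simp [max_eq_right (mem_Iio.1 hs).le]
  · have hO : (fun h : ℝ => (max h 0) ^ 2) =O[𝓝 0] fun h : ℝ => h ^ 2 := by
      refine Asymptotics.IsBigO.of_norm_le fun s => ?_
      rw [Real.norm_of_nonneg (sq_nonneg _)]
      rcases le_total s 0 with hs | hs
      · rw [max_eq_right hs, zero_pow two_ne_zero]; positivity
      · rw [max_eq_left hs]
    have ho := hO.trans_isLittleO
      (Asymptotics.isLittleO_pow_pow (𝕜 := ℝ) (show 1 < 2 by norm_num))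
    rw [hasDerivAt_iff_isLittleO]
    simpa using ho
  · rw [max_eq_left h.le]
    have h2 : HasDerivAt (fun s : ℝ => s ^ 2) (2 * r) r := by simpa using hasDerivAt_pow 2 r
    refine h2.congr_of_eventuallyEq ?_
    filter_upwards [Ioi_mem_nhds h] with s hs
    simp [max_eq_left (mem_Ioi.1 hs).le]

lemma IsPreconnected.pos_of_ne_zero {f : ℝ → ℝ} {s : Set ℝ} (hs : IsPreconnected s)
    (hf : ContinuousOn f s) (hne : ∀ x ∈ s, f x ≠ 0) {a : ℝ} (ha : a ∈ s) (hpos : 0 < f a) :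
    ∀ x ∈ s, 0 < f x := by
  intro x hx
  by_contra hle
  obtain ⟨y, hy, hy0⟩ := hs.intermediate_value hx ha hf ⟨not_lt.1 hle, hpos.le⟩
  exact hne y hy hy0

lemma Function.Periodic.eq_of_antitone {g : ℝ → ℝ} {T : ℝ} (hg : Function.Periodic g T)
    (hT : 0 < T) (ha : Antitone g) (s t : ℝ) : g s = g t := by
  have key : ∀ s t : ℝ, g s ≤ g t := by
    intro s t
    obtain ⟨n, hn⟩ := exists_nat_ge ((t - s) / T)
    rw [div_le_iff₀ hT] at hn
    rw [← hg.nat_mul n s]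
    exact ha (by linarith)
  exact le_antisymm (key s t) (key t s)

/-- If `W` decreases wherever it exceeds `R` and `R < W t₀`, then `W t₀` bounds from below the
earlier values of `W`. -/
lemma le_of_hasDerivAt_nonpos_of_lt {W W' : ℝ → ℝ} {R t₀ : ℝ} (hW : ∀ t, HasDerivAt W (W' t) t)
    (hdec : ∀ t, R < W t → W' t ≤ 0) (h₀ : R < W t₀) {t : ℝ} (ht : t ≤ t₀) : W t₀ ≤ W t := by
  by_contra! hlt
  have hcont : Continuous W := continuous_iff_continuousAt.2 fun t => (hW t).continuousAt
  set c := max R (W t) with hc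
  have hc₀ : c < W t₀ := max_lt h₀ hlt
  have hcomp : IsCompact (Icc t t₀ ∩ {s | W s ≤ c}) :=
    isCompact_Icc.inter_right (isClosed_le hcont continuous_const)
  obtain ⟨u, ⟨hu, huc⟩, hmax⟩ :=
    hcomp.exists_isGreatest ⟨t, ⟨le_rfl, ht⟩, le_max_right R (W t)⟩
  have hanti : AntitoneOn W (Icc u t₀) := by
    refine antitoneOn_of_hasDerivWithinAt_nonpos (convex_Icc _ _) hcont.continuousOn
      (fun s _ => (hW s).hasDerivWithinAt) fun s hs => hdec s ?_
    rw [interior_Icc] at hs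
    by_contra! hR
    have := hmax ⟨⟨hu.1.trans hs.1.le, hs.2.le⟩, hR.trans (le_max_left _ _)⟩
    exact absurd hs.1 (not_lt.2 this)
  have := hanti (left_mem_Icc.2 hu.2) (right_mem_Icc.2 hu.2) hu.2
  have huc' : W u ≤ c := huc
  linarith

/-- A periodic function which decreases wherever it exceeds `R` is constant
once it exceeds `R` somewhere. -/
lemma Function.Periodic.const_of_hasDerivAt_nonpos_of_lt {W W' : ℝ → ℝ} {R T t₀ : ℝ}
    (hper : Function.Periodic W T) (hT : 0 < T) (hW : ∀ t, HasDerivAt W (W' t) t)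
    (hdec : ∀ t, R < W t → W' t ≤ 0) (h₀ : R < W t₀) : ∀ t, R < W t ∧ W' t = 0 := by
  have hR : ∀ t, R < W t := by
    intro t
    obtain ⟨n, hn⟩ := exists_nat_ge ((t - t₀) / T)
    rw [div_le_iff₀ hT] at hn
    rw [← hper.sub_nat_mul_eq n]
    exact h₀.trans_le (le_of_hasDerivAt_nonpos_of_lt hW hdec h₀ (by linarith))
  intro t
  refine ⟨hR t, ?_⟩
  have hconst := hper.eq_of_antitone hT (antitone_of_hasDerivAt_nonpos hW fun t => hdec t (hR t))
  have hc : HasDerivAt W 0 t := by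
    rw [show W = fun _ => W t from funext fun s => hconst s t]
    exact hasDerivAt_const t (W t)
  exact (hW t).unique hc

/-- A `C¹` nondecreasing curve lying above the graph of `F` left of `d`, constant and below that
graph right of `d`. -/
lemma exists_barrier {F f : ℝ → ℝ} (hF : ∀ x, HasDerivAt F (f x) x) (hf : Continuous f)
    {M e d : ℝ} (he : 0 < e) (hed : e < d) (hM : ∀ x ≤ e, F x ≤ M) (hMe : F e = M)
    (hpos : ∀ x, e ≤ x → 0 < f x) :
    ∃ (κ κ' : ℝ → ℝ) (V : ℝ), 0 ≤ V ∧ (∀ x, HasDerivAt κ (κ' x) x) ∧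
      (∀ x < d, 0 < κ' x ∧ F x ≤ κ x) ∧ (∀ x, d ≤ x → κ' x = 0 ∧ κ x ≤ F x) ∧
      (∀ x, 0 ≤ x → x < d → x * (κ x - F x) ≤ V * κ' x) ∧ ∀ x, M ≤ κ x := by
  have hFc : Continuous F := continuous_iff_continuousAt.2 fun x => (hF x).continuousAt
  have hd : 0 < d := he.trans hed
  have hmono : StrictMonoOn F (Ici e) := by
    refine strictMonoOn_of_deriv_pos (convex_Ici _) hFc.continuousOn fun x hx => ?_
    rw [interior_Ici] at hx
    rw [(hF x).deriv]
    exact hpos x (mem_Ioi.1 hx).le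
  obtain ⟨p, hp, hpmin⟩ := isCompact_Icc.exists_isMinOn (nonempty_Icc.2 hed.le) hf.continuousOn
  obtain ⟨q, hq, hqmax⟩ := isCompact_Icc.exists_isMaxOn
    (nonempty_Icc.2 hd.le) hf.continuousOn
  have hc : 0 < f p := hpos p hp.1
  have hMd : M < F d := hMe ▸ hmono self_mem_Ici hed.le hed
  obtain ⟨s, hs, hsM, hsc⟩ : ∃ s, 0 < s ∧ s ≤ F d - M ∧ s ≤ f p :=
    ⟨min (F d - M) (f p), lt_min (by linarith) hc, min_le_left _ _, min_le_right _ _⟩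
  have hlow : ∀ x ∈ Icc e d, s * (d - x) ≤ F d - F x := by
    intro x hx
    have := (convex_Icc e d).mul_sub_le_image_sub_of_le_deriv hFc.continuousOn
      (fun x _ => (hF x).differentiableAt.differentiableWithinAt) (C := s)
      (fun y hy => by
        rw [(hF y).deriv]
        exact hsc.trans (hpmin (interior_subset hy))) x hx d (right_mem_Icc.2 hed.le) hx.2
    exact this
  have hup : ∀ x ∈ Icc 0 d, F d - F x ≤ f q * (d - x) := by
    intro x hx
    have := (convex_Icc 0 d).image_sub_le_mul_sub_of_deriv_le hFc.continuousOn
      (fun x _ => (hF x).differentiableAt.differentiableWithinAt) (C := f q)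
      (fun y hy => by
        rw [(hF y).deriv]
        exact hqmax (interior_subset hy)) x hx d (right_mem_Icc.2 hd.le) hx.2
    exact this
  have hL : 0 < f q := hc.trans_le (hqmax ⟨he.le.trans hp.1, hp.2⟩)
  have hle1 : ∀ g : ℝ, g ^ 2 / (1 + g ^ 2) ≤ 1 := fun g => by
    rw [div_le_one (by positivity)]
    linarith
  have hleg : ∀ g : ℝ, 0 ≤ g → g ^ 2 / (1 + g ^ 2) ≤ g := fun g hg => by
    rw [div_le_iff₀ (by positivity)]
    nlinarith [mul_nonneg hg (sq_nonneg (g - 1))]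
  have hsq : ∀ x : ℝ, (max (d - x) 0) ^ 2 / (1 + (d - x) ^ 2) ≤ 1 := fun x => by
    refine (div_le_div_of_nonneg_right ?_ (by positivity)).trans (hle1 (d - x))
    rcases le_total (d - x) 0 with h | h
    · rw [max_eq_right h, zero_pow two_ne_zero]; positivity
    · rw [max_eq_left h]
  refine ⟨fun x => F d - s * ((max (d - x) 0) ^ 2 / (1 + (d - x) ^ 2)),
    fun x => s * (2 * max (d - x) 0 / (1 + (d - x) ^ 2) ^ 2),
    d * f q * (1 + d ^ 2) ^ 2 / s, by positivity, ?_, ?_, ?_, ?_, ?_⟩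
  · intro x
    have h0 : HasDerivAt (fun x => d - x) (-1) x := by
      simpa using (hasDerivAt_id x).const_sub d
    have h1 := (hasDerivAt_max_zero_sq (d - x)).comp x h0
    have h2 := (h0.fun_pow 2).const_add 1
    have hne : 1 + (d - x) ^ 2 ≠ 0 := by positivity
    refine (((h1.fun_div h2 hne).const_mul s).const_sub (F d)).congr_deriv ?_
    simp only [Function.comp]
    rcases le_total (d - x) 0 with h | h
    · rw [max_eq_right h]; simp
    · rw [max_eq_left h]
      field_simp
      ring
  · intro x hx
    have hdx : 0 < d - x := sub_pos.2 hx
    simp only [max_eq_left hdx.le]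
    refine ⟨by positivity, ?_⟩
    rcases le_total x e with h | h
    · nlinarith [hM x h, hle1 (d - x)]
    · nlinarith [hlow x ⟨h, hx.le⟩, hleg (d - x) hdx.le]
  · intro x hx
    have hdx : d - x ≤ 0 := sub_nonpos.2 hx
    simp only [max_eq_right hdx]
    refine ⟨by simp, ?_⟩
    have := hmono.monotoneOn hed.le (hed.le.trans hx) hx
    simpa using this
  · intro x hx0 hx
    have hdx : 0 < d - x := sub_pos.2 hx
    simp only [max_eq_left hdx.le]
    have h1 : x * (F d - s * ((d - x) ^ 2 / (1 + (d - x) ^ 2)) - F x) ≤ d * (f q * (d - x)) := by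
      have hu := hup x ⟨hx0, hx.le⟩
      have h2 : 0 ≤ s * ((d - x) ^ 2 / (1 + (d - x) ^ 2)) := by positivity
      have h3 : 0 ≤ f q * (d - x) := by positivity
      calc _ ≤ x * (f q * (d - x)) := by gcongr; linarith
        _ ≤ _ := by gcongr
    have h4 : (1 + (d - x) ^ 2) ^ 2 ≤ (1 + d ^ 2) ^ 2 := by
      gcongr
      linarith
    have h5 : d * f q * (1 + d ^ 2) ^ 2 / s * (s * (2 * (d - x) / (1 + (d - x) ^ 2) ^ 2))
        = d * f q * (2 * (d - x)) * ((1 + d ^ 2) ^ 2 / (1 + (d - x) ^ 2) ^ 2) := by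
      field_simp
    have h6 : 1 ≤ (1 + d ^ 2) ^ 2 / (1 + (d - x) ^ 2) ^ 2 := by
      rwa [one_le_div (by positivity)]
    have h7 : 0 < d * f q * (d - x) := by
      positivity
    rw [h5]
    nlinarith
  · intro x
    have := hsq x
    show M ≤ F d - s * _
    nlinarith

/-- The energy relative to a barrier `κ` decreases above it. -/
lemma barrier_energy_deriv {x z lam F κ κ' V d : ℝ} (hlam : 0 < lam) (hz : lam * κ < z)
    (hleft : x < d → 0 < κ' ∧ F ≤ κ) (hright : d ≤ x → κ' = 0 ∧ κ ≤ F) (hd : 0 < d)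
    (hmid : 0 ≤ x → x < d → x * (κ - F) ≤ V * κ' ∧ V < (z - lam * κ) ^ 2) :
    2 * x * (z - lam * F) + 2 * (z - lam * κ) * (-x - lam * (κ' * (z - lam * F))) ≤ 0 ∧
    (x < d →
      2 * x * (z - lam * F) + 2 * (z - lam * κ) * (-x - lam * (κ' * (z - lam * F))) < 0) := by
  have e : 2 * x * (z - lam * F) + 2 * (z - lam * κ) * (-x - lam * (κ' * (z - lam * F)))
      = 2 * lam * (x * (κ - F) - κ' * ((z - lam * κ) * (z - lam * F))) := by ring
  rw [e]
  have hlt : x < d → 2 * lam * (x * (κ - F) - κ' * ((z - lam * κ) * (z - lam * F))) < 0 := by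
    intro hx
    obtain ⟨hκ', hFκ⟩ := hleft hx
    have hzk : 0 < z - lam * κ := sub_pos.2 hz
    have hmul : lam * F ≤ lam * κ := by gcongr
    have hsq : (z - lam * κ) ^ 2 ≤ (z - lam * κ) * (z - lam * F) := by
      rw [sq]; gcongr
    refine mul_neg_of_pos_of_neg (by positivity) ?_
    rcases le_or_gt 0 x with h0 | h0
    · obtain ⟨h1, h2⟩ := hmid h0 hx
      nlinarith
    · have h1 : x * (κ - F) ≤ 0 := mul_nonpos_of_nonpos_of_nonneg h0.le (sub_nonneg.2 hFκ)
      have h2 : 0 < κ' * ((z - lam * κ) * (z - lam * F)) :=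
        mul_pos hκ' ((by positivity : 0 < (z - lam * κ) ^ 2).trans_le hsq)
      linarith
  refine ⟨?_, hlt⟩
  rcases lt_or_ge x d with h | h
  · exact (hlt h).le
  · obtain ⟨h1, h2⟩ := hright h
    rw [h1, zero_mul, sub_zero]
    exact mul_nonpos_of_nonneg_of_nonpos (by positivity)
      (mul_nonpos_of_nonneg_of_nonpos (hd.le.trans h) (sub_nonpos.2 h2))

lemma IsPeriodicSol.exists_eq_zero {f : ℝ → ℝ} {lam : ℝ} {x y : ℝ → ℝ} (hf : Continuous f)
    (hlam : 0 < lam) (h : IsPeriodicSol f lam x y) : ∃ t, f (x t) = 0 := by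
  obtain ⟨⟨T, hT, hper⟩, hx, hy, t₁, t₂, hne⟩ := h
  by_contra! hf0
  have hxc : Continuous x := continuous_iff_continuousAt.2 fun t => (hx t).continuousAt
  have hE : ∀ t, HasDerivAt (fun t => x t ^ 2 + y t ^ 2) (-(2 * lam * (f (x t) * y t ^ 2))) t := by
    intro t
    refine (((hx t).fun_pow 2).fun_add ((hy t).fun_pow 2)).congr_deriv ?_
    simp only [Nat.cast_ofNat]
    ring
  have hEper : Function.Periodic (fun t => x t ^ 2 + y t ^ 2) T := fun t => by
    simp only [(hper t).1, (hper t).2]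
  have hconst : ∀ s t, x s ^ 2 + y s ^ 2 = x t ^ 2 + y t ^ 2 := by
    have hpre := isPreconnected_univ (α := ℝ)
    have hfx : ContinuousOn (fun t => f (x t)) univ := (hf.comp hxc).continuousOn
    rcases lt_or_gt_of_ne (hf0 0) with h0 | h0
    · have hneg := hpre.pos_of_ne_zero hfx.neg (fun t _ => neg_ne_zero.2 (hf0 t))
        (mem_univ 0) (neg_pos.2 h0)
      have hEn : Function.Periodic (fun t => -(x t ^ 2 + y t ^ 2)) T := fun t => by
        simp only [(hper t).1, (hper t).2]
      have ha := antitone_of_hasDerivAt_nonpos (fun t => (hE t).fun_neg) fun t => show _ ≤ (0 : ℝ) by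
        have h1 : 0 < -f (x t) := hneg t (mem_univ t)
        have : 0 ≤ 2 * lam * (-f (x t) * y t ^ 2) := by positivity
        linarith
      intro s t
      exact neg_injective (hEn.eq_of_antitone hT ha s t)
    · have hp := hpre.pos_of_ne_zero hfx (fun t _ => hf0 t) (mem_univ 0) h0
      have ha := antitone_of_hasDerivAt_nonpos hE fun t => show _ ≤ (0 : ℝ) by
        have h1 : 0 < f (x t) := hp t (mem_univ t)
        have : 0 ≤ 2 * lam * (f (x t) * y t ^ 2) := by positivity
        linarith
      exact hEper.eq_of_antitone hT ha
  have hy0 : ∀ t, y t = 0 := by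
    intro t
    have hc : HasDerivAt (fun t => x t ^ 2 + y t ^ 2) 0 t := by
      rw [show (fun t => x t ^ 2 + y t ^ 2) = fun _ => x t ^ 2 + y t ^ 2 from
        funext fun s => hconst s t]
      exact hasDerivAt_const t _
    have := (hE t).unique hc
    simpa [hlam.ne', hf0 t] using this
  have hx0 : ∀ t, x t = 0 := by
    intro t
    have hc : HasDerivAt y 0 t := by
      rw [show y = fun _ => 0 from funext hy0]
      exact hasDerivAt_const t _
    have := (hy t).unique hc
    simpa [hy0 t] using this
  simp [hx0, hy0] at hne

/-- If `f` is positive, negative, positive in turn, its primitive is maximal up to `x₂` at the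
first zero. -/
lemma le_of_sign_changes {F f : ℝ → ℝ} (hF : ∀ x, HasDerivAt F (f x) x) {p q x₂ : ℝ}
    (hpq : p < q) (hp : ∀ x < p, 0 < f x) (hpq' : ∀ x, p < x → x < q → f x < 0)
    (hq : ∀ x, q < x → 0 < f x) (hqx : q < x₂) (hFx : F x₂ = F p) : ∀ x ≤ x₂, F x ≤ F p := by
  have hFc : Continuous F := continuous_iff_continuousAt.2 fun x => (hF x).continuousAt
  have h1 : MonotoneOn F (Iic p) :=
    monotoneOn_of_hasDerivWithinAt_nonneg (convex_Iic _) hFc.continuousOn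
      (fun x _ => (hF x).hasDerivWithinAt) fun x hx => (hp x (by simpa using hx)).le
  have h2 : AntitoneOn F (Icc p q) :=
    antitoneOn_of_hasDerivWithinAt_nonpos (convex_Icc _ _) hFc.continuousOn
      (fun x _ => (hF x).hasDerivWithinAt) fun x hx => by
        rw [interior_Icc] at hx
        exact (hpq' x hx.1 hx.2).le
  have h3 : MonotoneOn F (Ici q) :=
    monotoneOn_of_hasDerivWithinAt_nonneg (convex_Ici _) hFc.continuousOn
      (fun x _ => (hF x).hasDerivWithinAt) fun x hx => (hq x (by simpa using hx)).le
  intro x hx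
  rcases le_total x p with h | h
  · exact h1 h self_mem_Iic h
  rcases le_total x q with h' | h'
  · exact h2 (left_mem_Icc.2 hpq.le) ⟨h, h'⟩ h
  · exact hFx ▸ h3 h' hqx.le hx

lemma sign_changes {f : ℝ → ℝ} (hf : Continuous f) {p q : ℝ} (hpq : p < q) (hfp : f p = 0)
    (hfq : f q = 0) (hz : ∀ x, f x = 0 → x = p ∨ x = q) (hdp : deriv f p < 0)
    (hdq : 0 < deriv f q) :
    (∀ x < p, 0 < f x) ∧ (∀ x, p < x → x < q → f x < 0) ∧ ∀ x, q < x → 0 < f x := by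
  have hp := eventually_nhdsWithin_sign_eq_of_deriv_neg hdp hfp
  have hq := eventually_nhdsWithin_sign_eq_of_deriv_pos hdq hfq
  refine ⟨?_, ?_, ?_⟩
  · obtain ⟨a, ha, hap⟩ := ((hp.filter_mono nhdsWithin_le_nhds).and
      (self_mem_nhdsWithin (a := p) (s := Iio p))).exists
    rw [sign_pos (sub_pos.2 hap)] at ha
    exact isPreconnected_Iio.pos_of_ne_zero hf.continuousOn
      (fun x hx h0 => by rcases hz x h0 with rfl | rfl <;> simp at hx; linarith) hap
      (sign_eq_one_iff.1 ha)
  · obtain ⟨a, ha, hap⟩ := ((hp.filter_mono nhdsWithin_le_nhds).and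
      (Ioo_mem_nhdsGT hpq)).exists
    rw [sign_neg (sub_neg.2 hap.1)] at ha
    have := isPreconnected_Ioo.pos_of_ne_zero hf.neg.continuousOn
      (fun x hx h0 => by
        rcases hz x (neg_eq_zero.1 h0) with rfl | rfl
        · exact lt_irrefl _ hx.1
        · exact lt_irrefl _ hx.2) hap
      (neg_pos.2 (sign_eq_neg_one_iff.1 ha))
    exact fun x h1 h2 => neg_pos.1 (this x ⟨h1, h2⟩)
  · obtain ⟨a, ha, haq⟩ := ((hq.filter_mono nhdsWithin_le_nhds).and
      (self_mem_nhdsWithin (a := q) (s := Ioi q))).exists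
    rw [sign_pos (sub_pos.2 haq)] at ha
    exact isPreconnected_Ioi.pos_of_ne_zero hf.continuousOn
      (fun x hx h0 => by rcases hz x h0 with rfl | rfl <;> simp at hx; linarith) haq
      (sign_eq_one_iff.1 ha)

/-- Nonconstant periodic solutions are bounded uniformly in `λ`. -/
lemma exists_bound_of_isPeriodicSol {F f : ℝ → ℝ} (hF : ∀ x, HasDerivAt F (f x) x)
    (hf : Continuous f) {xM xm x₁ x₂ : ℝ} (hxM : xM < 0) (hxm : 0 < xm)
    (hzeros : ∀ x, f x = 0 → x = xM ∨ x = xm)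
    (hleft : ∀ x < xM, 0 < f x) (hmid : ∀ x, xM < x → x < xm → f x < 0)
    (hright : ∀ x, xm < x → 0 < f x) (hx₁ : x₁ < xM) (hx₂ : xm < x₂)
    (hFx₁ : F x₁ = F xm) (hFx₂ : F x₂ = F xM) :
    ∃ R : ℝ, ∀ lam : ℝ, 0 < lam → ∀ x y : ℝ → ℝ, IsPeriodicSol f lam x y → ∀ t, x t ^ 2 ≤ R := by
  have hG : ∀ x, HasDerivAt (fun x => -F (-x)) (f (-x)) x := fun x => by
    exact ((hF (-x)).comp x (hasDerivAt_neg x)).fun_neg.congr_deriv (by ring)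
  have hFM := le_of_sign_changes hF (hxM.trans hxm) hleft hmid hright hx₂ hFx₂
  have hGM := le_of_sign_changes hG (p := -xm) (q := -xM) (x₂ := -x₁) (by linarith)
    (fun x hx => hright _ (by linarith)) (fun x h1 h2 => hmid _ (by linarith) (by linarith))
    (fun x hx => hleft _ (by linarith)) (by linarith) (by simpa using hFx₁)
  obtain ⟨d, hd₁, hd₂⟩ : ∃ d, -x₁ < d ∧ x₂ < d :=
    ⟨max (-x₁) x₂ + 1, by linarith [le_max_left (-x₁) x₂], by linarith [le_max_right (-x₁) x₂]⟩
  have hd : 0 < d := by linarith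
  obtain ⟨κ, κ', V, hV, hκ, hκl, hκr, hκm, hκM⟩ := exists_barrier hF hf (hxm.trans hx₂) hd₂ hFM hFx₂
    fun x hx => hright x (by linarith)
  obtain ⟨μ, μ', U, hU, hμ, hμl, hμr, hμm, hμM⟩ := exists_barrier hG (hf.comp continuous_neg)
    (show 0 < -x₁ by linarith) hd₁ hGM (by simpa using hFx₁) fun x hx => hleft _ (by linarith)
  have hμκ : ∀ x, -μ (-x) ≤ κ x := fun x => by
    have h1 := hκM x
    have h2 := hμM (-x)
    have h3 := hFM 0 (by linarith)
    have h4 := hGM 0 (by linarith)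
    simp only [neg_zero, neg_neg] at h2 h4
    linarith
  refine ⟨d ^ 2 + V + U, fun lam hlam x y hsol t₀ => ?_⟩
  obtain ⟨t₁, ht₁⟩ := hsol.exists_eq_zero hf hlam
  obtain ⟨⟨T, hT, hper⟩, hx, hy, -⟩ := hsol
  set z : ℝ → ℝ := fun t => y t + lam * F (x t) with hz
  have hxz : ∀ t, HasDerivAt x (z t - lam * F (x t)) t := fun t => by
    exact (hx t).congr_deriv (by simp [hz])
  have hz' : ∀ t, HasDerivAt z (-x t) t := fun t => by
    exact ((hy t).fun_add (((hF (x t)).comp t (hx t)).const_mul lam)).congr_deriv (by ring)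
  set W : ℝ → ℝ := fun t => x t ^ 2 + (max (z t - lam * κ (x t)) 0) ^ 2
    + (max (-z t - lam * μ (-x t)) 0) ^ 2 with hWdef
  set W' : ℝ → ℝ := fun t => 2 * x t * (z t - lam * F (x t))
    + 2 * max (z t - lam * κ (x t)) 0 * (-x t - lam * (κ' (x t) * (z t - lam * F (x t))))
    + 2 * max (-z t - lam * μ (-x t)) 0 *
      (x t - lam * (μ' (-x t) * -(z t - lam * F (x t)))) with hW'def
  have hW : ∀ t, HasDerivAt W (W' t) t := by
    intro t
    have h1 : HasDerivAt (fun t => x t ^ 2) (2 * x t * (z t - lam * F (x t))) t := by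
      simpa using (hxz t).fun_pow 2
    have h2 := (hasDerivAt_max_zero_sq (z t - lam * κ (x t))).comp t
      ((hz' t).sub (((hκ (x t)).comp t (hxz t)).const_mul lam))
    have h3 := (hasDerivAt_max_zero_sq (-z t - lam * μ (-x t))).comp t
      ((hz' t).neg.sub (((hμ (-x t)).comp t (hxz t).neg).const_mul lam))
    have h := (h1.add h2).add h3
    simp only [neg_neg] at h
    exact h
  have hWper : Function.Periodic W T := fun t => by
    simp only [hWdef, hz, (hper t).1, (hper t).2]
  have hdec : ∀ t, d ^ 2 + V + U < W t → W' t ≤ 0 ∧ (-d < x t → x t < d → W' t < 0) := by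
    intro t ht
    have hlk : lam * (-μ (-x t)) ≤ lam * κ (x t) := by gcongr; exact hμκ _
    have hsq : ∀ u : ℝ, -d < u → u < d → u ^ 2 < d ^ 2 := fun u h1 h2 => sq_lt_sq' h1 h2
    rcases lt_or_ge (lam * κ (x t)) (z t) with hzk | hzk
    · have hn : -z t - lam * μ (-x t) ≤ 0 := by linarith
      simp only [hWdef, hW'def, max_eq_right hn, max_eq_left (sub_pos.2 hzk).le] at ht ⊢
      have := barrier_energy_deriv (V := V) hlam hzk (hκl (x t)) (hκr (x t)) hd
        fun h0 h1 => ⟨hκm _ h0 h1, by linarith [hsq (x t) (by linarith) h1]⟩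
      simp only [mul_zero, zero_mul, add_zero]
      exact ⟨this.1, fun _ => this.2⟩
    · rcases lt_or_ge (lam * μ (-x t)) (-z t) with hzm | hzm
      · simp only [hWdef, hW'def, max_eq_right (sub_nonpos.2 hzk),
          max_eq_left (sub_pos.2 hzm).le] at ht ⊢
        have := barrier_energy_deriv (V := U) hlam hzm (hμl (-x t)) (hμr (-x t)) hd
          fun h0 h1 => ⟨hμm _ h0 h1, by linarith [hsq (x t) (by linarith) (by linarith)]⟩
        simp only [neg_neg] at this
        have e : 2 * x t * (z t - lam * F (x t))
            + 2 * 0 * (-x t - lam * (κ' (x t) * (z t - lam * F (x t))))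
            + 2 * (-z t - lam * μ (-x t)) *
              (x t - lam * (μ' (-x t) * -(z t - lam * F (x t))))
            = 2 * -x t * (-z t - lam * -F (x t)) + 2 * (-z t - lam * μ (-x t)) *
              (x t - lam * (μ' (-x t) * (-z t - lam * -F (x t)))) := by ring
        rw [e]
        exact ⟨this.1, fun h1 _ => this.2 (by linarith)⟩
      · simp only [hWdef, hW'def, max_eq_right (sub_nonpos.2 hzk),
          max_eq_right (sub_nonpos.2 hzm), mul_zero, zero_mul, add_zero] at ht ⊢
        have hnot : ¬(-d < x t ∧ x t < d) := fun h => by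
          have := hsq _ h.1 h.2
          linarith
        refine ⟨?_, fun h1 h2 => absurd ⟨h1, h2⟩ hnot⟩
        rcases lt_or_ge (x t) d with hxd | hxd
        · have hxd' : x t ≤ -d := not_lt.1 fun h => hnot ⟨h, hxd⟩
          have h1 := (hμr (-x t) (by linarith)).2
          rw [neg_neg] at h1
          have h2 : lam * F (x t) ≤ lam * -μ (-x t) := by gcongr; linarith
          exact mul_nonpos_of_nonpos_of_nonneg (by linarith) (by linarith)
        · have h1 := (hκr (x t) hxd).2
          have h2 : lam * κ (x t) ≤ lam * F (x t) := by gcongr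
          exact mul_nonpos_of_nonneg_of_nonpos (by linarith) (by linarith)
  by_contra! hlt
  have hW₀ : d ^ 2 + V + U < W t₀ := by
    simp only [hWdef]
    nlinarith [sq_nonneg (max (z t₀ - lam * κ (x t₀)) 0),
      sq_nonneg (max (-z t₀ - lam * μ (-x t₀)) 0)]
  obtain ⟨hR, h0⟩ := hWper.const_of_hasDerivAt_nonpos_of_lt hT hW (fun t ht => (hdec t ht).1) hW₀ t₁
  have hxt : -d < x t₁ ∧ x t₁ < d := by
    rcases hzeros _ ht₁ with h | h <;> rw [h] <;> constructor <;> linarith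
  exact ((hdec t₁ hR).2 hxt.1 hxt.2).ne h0

theorem limit_cycle_strip (f : ℝ → ℝ) (xM xm : ℝ)
    (hf : ContDiff ℝ 2 f)
    (hxM : xM < 0) (hxm : 0 < xm)
    (hfxM : f xM = 0) (hfxm : f xm = 0)
    (hzeros : ∀ x, f x = 0 → x = xM ∨ x = xm)
    (hdM : deriv f xM < 0) (hdm : 0 < deriv f xm)
    (F : ℝ → ℝ) (hF : ∀ x, F x = ∫ s in (0:ℝ)..x, f s)
    (x₁ x₂ : ℝ) (hx₁ : x₁ < xM) (hx₂ : xm < x₂)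
    (hFx₁ : F x₁ = F xm) (hFx₂ : F x₂ = F xM)
    (hA3 : ∀ lam : ℝ, 0 < lam → ∀ x y x' y' : ℝ → ℝ,
      IsPeriodicSol f lam x y → IsPeriodicSol f lam x' y' →
      Set.range (fun t => (x t, y t)) = Set.range (fun t => (x' t, y' t)))
    (ρ : ℝ) (hρpos : 0 < ρ)
    (hρzero : (∫ s in (-1:ℝ)..1, Real.sqrt (1 - s ^ 2) * f (ρ * s)) = 0)
    (hρuniq : ∀ r : ℝ, 0 < r →
      (∫ s in (-1:ℝ)..1, Real.sqrt (1 - s ^ 2) * f (r * s)) = 0 → r = ρ) :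
    (∃ x₀ : ℝ, max ρ (max (-x₁) x₂) < x₀ ∧
      ∀ lam : ℝ, 0 < lam → ∀ x y : ℝ → ℝ, IsPeriodicSol f lam x y →
        ∀ t, -x₀ < x t ∧ x t < x₀) ∧
    (∀ lam : ℝ, 0 < lam → ∀ x y : ℝ → ℝ, IsPeriodicSol f lam x y →
      ∃ t, x t = xM ∨ x t = xm) := by
  have hfc := hf.continuous
  have hF' : ∀ x, HasDerivAt F (f x) x := fun x => by
    rw [show F = fun x => ∫ s in (0:ℝ)..x, f s from funext hF]
    exact intervalIntegral.integral_hasDerivAt_right (hfc.intervalIntegrable _ _)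
      (hfc.stronglyMeasurableAtFilter _ _) hfc.continuousAt
  obtain ⟨hl, hm, hr⟩ := sign_changes hfc (hxM.trans hxm) hfxM hfxm hzeros hdM hdm
  refine ⟨?_, fun lam hlam x y h => ?_⟩
  · obtain ⟨R, hR⟩ := exists_bound_of_isPeriodicSol hF' hfc hxM hxm hzeros hl hm hr hx₁ hx₂ hFx₁ hFx₂
    refine ⟨max (√R) (max ρ (max (-x₁) x₂)) + 1,
      (le_max_right _ _).trans_lt (lt_add_one _), fun lam hlam x y h t => abs_lt.1 ?_⟩
    exact ((Real.abs_le_sqrt (hR lam hlam x y h t)).trans (le_max_left _ _)).trans_lt (lt_add_one _)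
  · obtain ⟨t, ht⟩ := h.exists_eq_zero hfc hlam
    exact ⟨t, hzeros _ ht⟩
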